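/- Let ζ : ℤ → {r,s} be a label configuration and let x ∈ ℤ satisfy ζ(x) = s and ζ(y) = r for all y ∈ {x−2, x−1, x+1, x+2}. Let η : ℤ → ℕ be any height configuration and let η̃ be obtained from η by one legal toppling at any single site of ℤ. Then η̃(x) ≡ η(x) (mod 2) and η̃(x−1) + η̃(x+1) ≡ η(x−1) + η(x+1) (mod 2). In words: topplings never change the parity of the height at x, nor the parity of the sum of the heights at x−1 and x+1. -/

import Mathlib

/-- Toppling labels: `r` (both particles to the right neighbor) and
`s` (one particle to each neighbor). -/
inductive Label : Type
  | r : Label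
  | s : Label
deriving DecidableEq

/-- One toppling at site `y` on `ℤ` in the environment `ζ`: site `y` loses two
particles; if `ζ y = r` both go to `y + 1`, and if `ζ y = s` one goes to each
of `y - 1` and `y + 1`. -/
def topple (ζ : ℤ → Label) (η : ℤ → ℕ) (y : ℤ) : ℤ → ℕ := fun z =>
  (η z - if z = y then 2 else 0)
    + (if ζ y = Label.r ∧ z = y + 1 then 2 else 0)
    + (if ζ y = Label.s ∧ z = y - 1 then 1 else 0)
    + (if ζ y = Label.s ∧ z = y + 1 then 1 else 0)

/-- if `ζ x = s` and `ζ y = r` for all `y ∈ {x-2, x-1, x+1, x+2}`,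
then a single legal toppling (at any site) changes neither the parity of the height
at `x` nor the parity of the sum of the heights at `x - 1` and `x + 1`. -/
theorem parity_invariants (ζ : ℤ → Label) (x : ℤ)
    (hx : ζ x = Label.s)
    (hm1 : ζ (x - 1) = Label.r) (hp1 : ζ (x + 1) = Label.r)
    (hm2 : ζ (x - 2) = Label.r) (hp2 : ζ (x + 2) = Label.r)
    (η η' : ℤ → ℕ)
    (hstep : ∃ y : ℤ, 2 ≤ η y ∧ η' = topple ζ η y) :
    η' x % 2 = η x % 2 ∧
      (η' (x - 1) + η' (x + 1)) % 2 = (η (x - 1) + η (x + 1)) % 2 := by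
  obtain ⟨y, hy, rfl⟩ := hstep
  by_cases h0 : y = x
  · subst h0
    simp [topple, hx]
    grind
  by_cases h1 : y = x - 1
  · subst h1
    simp [topple, hm1]
    grind
  by_cases h2 : y = x + 1
  · subst h2
    simp [topple, hp1]
    grind
  by_cases h3 : y = x - 2
  · subst h3
    simp [topple, hm2]
    grind
  by_cases h4 : y = x + 2
  · subst h4
    simp [topple, hp2]
    grind
  have e1 : x ≠ y + 1 := by omega
  have e2 : x ≠ y - 1 := by omega
  have e3 : x - 1 ≠ y := by omega
  have e4 : x - 1 ≠ y + 1 := by omega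
  have e5 : x - 1 ≠ y - 1 := by omega
  have e6 : x + 1 ≠ y := by omega
  have e7 : x + 1 ≠ y + 1 := by omega
  have e8 : x + 1 ≠ y - 1 := by omega
  simp only [topple, Ne.symm h0, e1, e2, e3, e4, e5, e6, e7, e8, and_false, if_false]
  simp
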